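/- arXiv:2006.05830 — 2 statements merged into one kernel-verified Lean document; each statement's English description precedes it below -/
import Mathlib

section
/- Let s ∈ (0,1), κ > 0, U ⊆ ℝ^N open, and let w ∈ C²(ℝ^N) ∩ W^{3,∞}(ℝ^N) satisfy (-Δ + (-Δ)^s) w + c(x) w = 0 in ℝ^N for a function c with c(x) ≥ κ for all x ∈ U, and suppose w(x) ≥ 0 for all x ∈ ℝ^N ∖ U. If moreover the infimum m := inf_{ℝ^N} w is attained at some point x₀ ∈ ℝ^N, then w(x) ≥ 0 for all x ∈ ℝ^N. -/
open MeasureTheory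

noncomputable section

/-- The Laplacian `Δw(x) = ∑ᵢ ∂²w/∂xᵢ²(x)`. -/
def lapl (N : ℕ) (w : EuclideanSpace ℝ (Fin N) → ℝ) (x : EuclideanSpace ℝ (Fin N)) : ℝ :=
  ∑ i : Fin N,
    fderiv ℝ (fun y => fderiv ℝ w y (EuclideanSpace.single i 1)) x (EuclideanSpace.single i 1)

/-- The fractional Laplacian `(-Δ)^s w(x)` via the second-difference formula. -/
def fracLap (N : ℕ) (s : ℝ) (w : EuclideanSpace ℝ (Fin N) → ℝ)
    (x : EuclideanSpace ℝ (Fin N)) : ℝ :=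
  (1 / 2) * ∫ z : EuclideanSpace ℝ (Fin N),
    (2 * w x - w (x + z) - w (x - z)) / ‖z‖ ^ ((N : ℝ) + 2 * s)

/-- The second-derivative necessary condition at a local minimum. -/
theorem IsLocalMin.deriv_deriv_nonneg {g : ℝ → ℝ} {a : ℝ} (hg : ContinuousAt g a)
    (hmin : IsLocalMin g a) : 0 ≤ deriv (deriv g) a := by
  by_contra! hneg
  have hmax : IsLocalMax g a := isLocalMax_of_deriv_deriv_neg hneg hmin.deriv_eq_zero hg
  have hconst : g =ᶠ[nhds a] fun _ => g a := by
    filter_upwards [hmin, hmax] with t h₁ h₂ using le_antisymm h₂ h₁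
  have hzero : deriv (deriv g) a = 0 := by
    rw [hconst.deriv.deriv_eq]
    simp
  exact hneg.ne hzero

/-- At a minimum of a `C²` function, every pure second directional derivative is nonnegative. -/
theorem fderiv_fderiv_apply_nonneg_of_forall_le {E : Type*} [NormedAddCommGroup E]
    [NormedSpace ℝ E] {w : E → ℝ} (hw : ContDiff ℝ 2 w) {x₀ : E} (hmin : ∀ x, w x₀ ≤ w x)
    (v : E) : 0 ≤ fderiv ℝ (fun y => fderiv ℝ w y v) x₀ v := by
  have hline (t : ℝ) : HasDerivAt (fun t : ℝ => x₀ + t • v) v t := by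
    simpa using ((hasDerivAt_id t).smul_const v).const_add x₀
  have hd : Differentiable ℝ w := hw.differentiable (by norm_num)
  have hd' : Differentiable ℝ (fun y => fderiv ℝ w y v) :=
    ((hw.fderiv_right (m := 1) (by norm_num)).differentiable (by norm_num)).clm_apply
      (differentiable_const v)
  have hderiv : deriv (fun t : ℝ => w (x₀ + t • v)) = fun t => fderiv ℝ w (x₀ + t • v) v :=
    funext fun t => ((hd _).hasFDerivAt.comp_hasDerivAt t (hline t)).deriv
  have hderiv₂ : deriv (fun t : ℝ => fderiv ℝ w (x₀ + t • v) v) 0 =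
      fderiv ℝ (fun y => fderiv ℝ w y v) x₀ v := by
    simpa [Function.comp_def] using ((hd' _).hasFDerivAt.comp_hasDerivAt (0 : ℝ) (hline 0)).deriv
  rw [← hderiv₂, ← hderiv]
  refine IsLocalMin.deriv_deriv_nonneg ?_ (Filter.Eventually.of_forall fun t => ?_)
  · exact ((hd _).hasFDerivAt.comp_hasDerivAt (0 : ℝ) (hline 0)).continuousAt
  · simpa using hmin (x₀ + t • v)

theorem lapl_nonneg_of_forall_le {N : ℕ} {w : EuclideanSpace ℝ (Fin N) → ℝ}
    (hw : ContDiff ℝ 2 w) {x₀ : EuclideanSpace ℝ (Fin N)} (hmin : ∀ x, w x₀ ≤ w x) :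
    0 ≤ lapl N w x₀ :=
  Finset.sum_nonneg fun _ _ => fderiv_fderiv_apply_nonneg_of_forall_le hw hmin _

theorem fracLap_nonpos_of_forall_le {N : ℕ} (s : ℝ) {w : EuclideanSpace ℝ (Fin N) → ℝ}
    {x₀ : EuclideanSpace ℝ (Fin N)} (hmin : ∀ x, w x₀ ≤ w x) : fracLap N s w x₀ ≤ 0 := by
  refine mul_nonpos_of_nonneg_of_nonpos (by norm_num) (integral_nonpos fun z => ?_)
  refine div_nonpos_of_nonpos_of_nonneg ?_ (by positivity)
  linarith [hmin (x₀ + z), hmin (x₀ - z)]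

/-- maximum principle with attained infimum. If
`(-Δ + (-Δ)^s)w + c w = 0` in `ℝ^N`, `c ≥ κ > 0` on `U`, `w ≥ 0` outside `U`, and the
infimum of `w` is attained, then `w ≥ 0` everywhere. -/
theorem stmt7 (N : ℕ) (hN : 1 ≤ N) (s : ℝ) (hs : s ∈ Set.Ioo (0 : ℝ) 1)
    (κ : ℝ) (hκ : 0 < κ)
    (U : Set (EuclideanSpace ℝ (Fin N))) (hU : IsOpen U)
    (w : EuclideanSpace ℝ (Fin N) → ℝ) (c : EuclideanSpace ℝ (Fin N) → ℝ)
    (hw : ContDiff ℝ 2 w)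
    (hbdd : ∃ C, ∀ n : ℕ, n ≤ 2 → ∀ x, ‖iteratedFDeriv ℝ n w x‖ ≤ C)
    (heq : ∀ x, (-lapl N w x + fracLap N s w x) + c x * w x = 0)
    (hc : ∀ x ∈ U, κ ≤ c x)
    (hout : ∀ x ∉ U, 0 ≤ w x)
    (hmin : ∃ x₀, ∀ x, w x₀ ≤ w x) :
    ∀ x, 0 ≤ w x := by
  obtain ⟨x₀, hx₀⟩ := hmin
  suffices h : 0 ≤ w x₀ from fun x => h.trans (hx₀ x)
  by_contra! hneg
  have hx₀U : x₀ ∈ U := by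
    by_contra hx
    exact hneg.not_ge (hout x₀ hx)
  have hcw : c x₀ * w x₀ < 0 := mul_neg_of_pos_of_neg (hκ.trans_le (hc x₀ hx₀U)) hneg
  linarith [heq x₀, lapl_nonneg_of_forall_le hw hx₀, fracLap_nonpos_of_forall_le s hx₀]
end
end

section
/- Let s ∈ (0,1), f ∈ C¹(ℝ) with sup_{|r|≥1} f'(r) < 0, and suppose u ∈ C³(ℝ^N) ∩ W^{4,∞}(ℝ^N) solves (-Δ + (-Δ)^s) u = f(u) in ℝ^N (pointwise) with lim_{t→±∞} u(y,t) = ±1 uniformly in y ∈ ℝ^{N-1}. Then every partial derivative ∂_i u for i = 1, …, N-1 in the y-variables vanishes identically; equivalently, there exists u₀ : ℝ → ℝ such that u(y,t) = u₀(t) for all (y,t) ∈ ℝ^{N-1} × ℝ. -/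
open MeasureTheory

noncomputable section

/-- A `C²` function whose derivatives up to order two are bounded. -/
def IsC2Bdd {N : ℕ} (w : EuclideanSpace ℝ (Fin N) → ℝ) : Prop :=
  ContDiff ℝ 2 w ∧ ∃ C, ∀ n : ℕ, n ≤ 2 → ∀ x, ‖iteratedFDeriv ℝ n w x‖ ≤ C

namespace IsC2Bdd

variable {N : ℕ} {w v : EuclideanSpace ℝ (Fin N) → ℝ}

theorem comp_add_right (hw : IsC2Bdd w) (h : EuclideanSpace ℝ (Fin N)) :
    IsC2Bdd (fun x => w (x + h)) := by
  obtain ⟨hw, C, hC⟩ := hw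
  refine ⟨hw.comp (contDiff_id.add contDiff_const), C, fun n hn x => ?_⟩
  rw [iteratedFDeriv_comp_add_right]
  exact hC n hn _

theorem sub (hw : IsC2Bdd w) (hv : IsC2Bdd v) : IsC2Bdd (fun x => w x - v x) := by
  obtain ⟨hw, C, hC⟩ := hw
  obtain ⟨hv, D, hD⟩ := hv
  refine ⟨hw.sub hv, C + D, fun n hn x => ?_⟩
  have hn' : ((n : ℕ) : WithTop ℕ∞) ≤ 2 := by exact_mod_cast hn
  rw [fun_iteratedFDeriv_sub_apply (hw.of_le hn').contDiffAt (hv.of_le hn').contDiffAt]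
  exact (norm_sub_le _ _).trans (add_le_add (hC n hn x) (hD n hn x))

theorem const_mul (hw : IsC2Bdd w) (a : ℝ) : IsC2Bdd (fun x => a * w x) := by
  obtain ⟨hw, C, hC⟩ := hw
  refine ⟨contDiff_const.mul hw, |a| * C, fun n hn x => ?_⟩
  have hn' : ((n : ℕ) : WithTop ℕ∞) ≤ 2 := by exact_mod_cast hn
  have := iteratedFDeriv_const_smul_apply' (a := a) (hw.of_le hn').contDiffAt (x := x)
  simp only [smul_eq_mul] at this
  rw [this, norm_smul, Real.norm_eq_abs]
  exact mul_le_mul_of_nonneg_left (hC n hn x) (abs_nonneg a)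

theorem of_hasCompactSupport (hw : ContDiff ℝ 2 w) (hc : HasCompactSupport w) : IsC2Bdd w := by
  have key : ∀ n : ℕ, n ≤ 2 → ∃ C, ∀ x, ‖iteratedFDeriv ℝ n w x‖ ≤ C := by
    intro n hn
    have hn' : ((n : ℕ) : WithTop ℕ∞) ≤ 2 := by exact_mod_cast hn
    exact (hc.iteratedFDeriv n).exists_bound_of_continuous (hw.continuous_iteratedFDeriv hn')
  choose! C hC using key
  refine ⟨hw, max (C 0) (max (C 1) (C 2)), fun n hn x => (hC n hn x).trans ?_⟩
  interval_cases n <;> simp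

theorem exists_abs_le (hw : IsC2Bdd w) : ∃ C, ∀ x, |w x| ≤ C := by
  obtain ⟨-, C, hC⟩ := hw
  exact ⟨C, fun x => by simpa using hC 0 (by norm_num) x⟩

theorem exists_lipschitz (hw : IsC2Bdd w) : ∃ L, 0 ≤ L ∧ ∀ x y, |w x - w y| ≤ L * ‖x - y‖ := by
  obtain ⟨hw, C, hC⟩ := hw
  refine ⟨C, (norm_nonneg _).trans (hC 0 (by norm_num) 0), fun x y => ?_⟩
  refine convex_univ.norm_image_sub_le_of_norm_fderiv_le (𝕜 := ℝ)
    (fun z _ => hw.differentiable (by norm_num) z) (fun z _ => ?_) (Set.mem_univ _) (Set.mem_univ _)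
  rw [← norm_iteratedFDeriv_one]
  exact hC 1 (by norm_num) z

theorem exists_fderiv_lipschitz (hw : IsC2Bdd w) :
    ∃ L, 0 ≤ L ∧ ∀ x y, ‖fderiv ℝ w x - fderiv ℝ w y‖ ≤ L * ‖x - y‖ := by
  obtain ⟨hw, C, hC⟩ := hw
  refine ⟨C, (norm_nonneg _).trans (hC 0 (by norm_num) 0), fun x y => ?_⟩
  have hd : ContDiff ℝ 1 (fderiv ℝ w) := hw.fderiv_right (by norm_num)
  refine convex_univ.norm_image_sub_le_of_norm_fderiv_le (𝕜 := ℝ)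
    (fun z _ => hd.differentiable (by norm_num) z) (fun z _ => ?_) (Set.mem_univ _) (Set.mem_univ _)
  rw [← norm_iteratedFDeriv_one, norm_iteratedFDeriv_fderiv]
  exact hC 2 le_rfl z

/-- Second differences are `O(min(1, ‖z‖²))`, uniformly in the base point. -/
theorem exists_second_difference_le (hw : IsC2Bdd w) : ∃ C, 0 ≤ C ∧ ∀ x z,
    |2 * w x - w (x + z) - w (x - z)| ≤ C * min 1 (‖z‖ ^ 2) := by
  obtain ⟨A, hA⟩ := hw.exists_abs_le
  obtain ⟨L, hL0, hL⟩ := hw.exists_fderiv_lipschitz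
  have hA0 : 0 ≤ A := (abs_nonneg _).trans (hA 0)
  refine ⟨4 * A + 2 * L, by positivity, fun x z => ?_⟩
  have h1 : |2 * w x - w (x + z) - w (x - z)| ≤ 4 * A := by
    have a := abs_le.1 (hA x)
    have b := abs_le.1 (hA (x + z))
    have c := abs_le.1 (hA (x - z))
    rw [abs_le]; constructor <;> linarith [a.1, a.2, b.1, b.2, c.1, c.2]
  have h2 : |2 * w x - w (x + z) - w (x - z)| ≤ 2 * L * ‖z‖ ^ 2 := by
    have hd : Differentiable ℝ w := hw.1.differentiable (by norm_num)
    have hder : ∀ t : ℝ, HasDerivAt (fun t : ℝ => w (x + t • z) + w (x - t • z))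
        (fderiv ℝ w (x + t • z) z - fderiv ℝ w (x - t • z) z) t := by
      intro t
      have e1 : HasDerivAt (fun t : ℝ => x + t • z) z t := by
        simpa using ((hasDerivAt_id t).smul_const z).const_add x
      have e2 : HasDerivAt (fun t : ℝ => x - t • z) (-z) t := by
        simpa using ((hasDerivAt_id t).smul_const z).const_sub x
      have := ((hd (x + t • z)).hasFDerivAt.comp_hasDerivAt t e1).add
        ((hd (x - t • z)).hasFDerivAt.comp_hasDerivAt t e2)
      simpa [sub_eq_add_neg, Function.comp_def, Pi.add_def] using this
    have := norm_image_sub_le_of_norm_deriv_le_segment_01'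
      (f := fun t : ℝ => w (x + t • z) + w (x - t • z)) (C := 2 * L * ‖z‖ ^ 2)
      (fun t _ => (hder t).hasDerivWithinAt) (fun t ht => by
        rw [← _root_.sub_apply]
        refine (ContinuousLinearMap.le_opNorm _ _).trans ?_
        have e := hL (x + t • z) (x - t • z)
        have e' : x + t • z - (x - t • z) = (2 * t) • z := by module
        rw [e', norm_smul, Real.norm_eq_abs, abs_of_nonneg (by linarith [ht.1])] at e
        have e3 : ‖fderiv ℝ w (x + t • z) - fderiv ℝ w (x - t • z)‖ ≤ 2 * L * ‖z‖ := by
          refine e.trans ?_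
          have : 0 ≤ L * ‖z‖ := by positivity
          nlinarith [ht.2]
        calc _ ≤ (2 * L * ‖z‖) * ‖z‖ := mul_le_mul_of_nonneg_right e3 (norm_nonneg _)
          _ = _ := by ring)
    simp only [one_smul, zero_smul, add_zero, sub_zero, Real.norm_eq_abs] at this
    rw [← abs_neg]
    convert this using 2
    ring
  rcases le_total 1 (‖z‖ ^ 2) with h | h
  · rw [min_eq_left h]; linarith
  · rw [min_eq_right h]
    have : 0 ≤ 4 * A * ‖z‖ ^ 2 := by positivity
    linarith

end IsC2Bdd

/-- The kernel `min(1, ‖z‖²) / ‖z‖^(N + 2s)` is integrable for `0 < s < 1`. -/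
theorem integrable_min_one_sq_div_norm_rpow (d : ℕ) {s : ℝ} (hs : s ∈ Set.Ioo (0 : ℝ) 1) :
    Integrable (fun z : EuclideanSpace ℝ (Fin (d + 1)) =>
      min 1 (‖z‖ ^ 2) / ‖z‖ ^ (((d + 1 : ℕ) : ℝ) + 2 * s)) := by
  have := integrable_fun_norm_addHaar (volume : Measure (EuclideanSpace ℝ (Fin (d + 1))))
    (f := fun r : ℝ => min 1 (r ^ 2) / r ^ (((d + 1 : ℕ) : ℝ) + 2 * s))
  rw [this, finrank_euclideanSpace_fin, Nat.add_sub_cancel, ← Set.Ioc_union_Ioi_eq_Ioi zero_le_one]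
  refine IntegrableOn.union ?_ ?_
  · have h := (intervalIntegral.intervalIntegrable_rpow' (a := 0) (b := 1)
      (r := 1 - 2 * s) (by linarith [hs.2]))
    rw [intervalIntegrable_iff, Set.uIoc_of_le zero_le_one] at h
    refine h.congr_fun (fun r hr => ?_) measurableSet_Ioc
    have hr0 : 0 < r := hr.1
    have : min 1 (r ^ 2) = r ^ 2 := min_eq_right (pow_le_one₀ hr0.le hr.2)
    simp only [smul_eq_mul, this]
    rw [← Real.rpow_natCast r d, ← Real.rpow_natCast r 2, ← Real.rpow_sub hr0, ← Real.rpow_add hr0]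
    congr 1
    push_cast
    ring
  · have h := integrableOn_Ioi_rpow_of_lt (a := -1 - 2 * s) (by linarith [hs.1]) zero_lt_one
    refine h.congr_fun (fun r hr => ?_) measurableSet_Ioi
    have hr1 : 1 < r := hr
    have hr0 : 0 < r := by linarith
    have : min 1 (r ^ 2) = 1 := min_eq_left (one_le_pow₀ hr1.le)
    simp only [smul_eq_mul, this]
    rw [← Real.rpow_natCast r d, one_div, ← Real.rpow_neg hr0.le, ← Real.rpow_add hr0]
    congr 1
    push_cast
    ring

section MixedOperator

variable {d : ℕ} {s : ℝ} {w v g : EuclideanSpace ℝ (Fin (d + 1)) → ℝ}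

theorem IsC2Bdd.integrable_fracLap (hs : s ∈ Set.Ioo (0 : ℝ) 1) (hw : IsC2Bdd w)
    (x : EuclideanSpace ℝ (Fin (d + 1))) :
    Integrable (fun z : EuclideanSpace ℝ (Fin (d + 1)) =>
      (2 * w x - w (x + z) - w (x - z)) / ‖z‖ ^ (((d + 1 : ℕ) : ℝ) + 2 * s)) := by
  obtain ⟨C, hC0, hC⟩ := hw.exists_second_difference_le
  have hc := hw.1.continuous
  refine ((integrable_min_one_sq_div_norm_rpow d hs).const_mul C).mono' ?_ (.of_forall fun z => ?_)
  · refine Measurable.aestronglyMeasurable ?_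
    have : Measurable w := hc.measurable
    fun_prop
  · rw [norm_div, Real.norm_eq_abs, Real.norm_of_nonneg (Real.rpow_nonneg (norm_nonneg z) _),
      ← mul_div_assoc]
    exact div_le_div_of_nonneg_right (hC x z) (Real.rpow_nonneg (norm_nonneg z) _)

theorem IsC2Bdd.exists_abs_fracLap_le (hs : s ∈ Set.Ioo (0 : ℝ) 1) (hw : IsC2Bdd w) :
    ∃ C, ∀ x, |fracLap (d + 1) s w x| ≤ C := by
  obtain ⟨C, hC0, hC⟩ := hw.exists_second_difference_le
  refine ⟨1 / 2 * ∫ z : EuclideanSpace ℝ (Fin (d + 1)),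
    C * (min 1 (‖z‖ ^ 2) / ‖z‖ ^ (((d + 1 : ℕ) : ℝ) + 2 * s)), fun x => ?_⟩
  rw [fracLap, abs_mul, abs_of_nonneg (by norm_num : (0 : ℝ) ≤ 1 / 2)]
  refine mul_le_mul_of_nonneg_left ?_ (by norm_num)
  rw [← Real.norm_eq_abs]
  refine norm_integral_le_of_norm_le
    ((integrable_min_one_sq_div_norm_rpow d hs).const_mul C) (.of_forall fun z => ?_)
  rw [norm_div, Real.norm_eq_abs, Real.norm_of_nonneg (Real.rpow_nonneg (norm_nonneg z) _),
    ← mul_div_assoc]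
  exact div_le_div_of_nonneg_right (hC x z) (Real.rpow_nonneg (norm_nonneg z) _)

theorem fracLap_sub (hs : s ∈ Set.Ioo (0 : ℝ) 1) (hw : IsC2Bdd w) (hv : IsC2Bdd v)
    (x : EuclideanSpace ℝ (Fin (d + 1))) :
    fracLap (d + 1) s (fun y => w y - v y) x = fracLap (d + 1) s w x - fracLap (d + 1) s v x := by
  unfold fracLap
  rw [← mul_sub, ← integral_sub (hw.integrable_fracLap hs x) (hv.integrable_fracLap hs x)]
  congr 2
  ext z
  ring

theorem fracLap_const_mul (a : ℝ) (x : EuclideanSpace ℝ (Fin (d + 1))) :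
    fracLap (d + 1) s (fun y => a * w y) x = a * fracLap (d + 1) s w x := by
  unfold fracLap
  rw [mul_left_comm a, ← integral_const_mul a]
  congr 2
  ext z
  ring

theorem fracLap_comp_add_right (h x : EuclideanSpace ℝ (Fin (d + 1))) :
    fracLap (d + 1) s (fun y => w (y + h)) x = fracLap (d + 1) s w (x + h) := by
  unfold fracLap
  congr 2
  ext z
  simp only [add_right_comm x z h, sub_add_eq_add_sub x z h]

theorem lapl_comp_add_right (h x : EuclideanSpace ℝ (Fin (d + 1))) :
    lapl (d + 1) (fun y => w (y + h)) x = lapl (d + 1) w (x + h) := by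
  unfold lapl
  refine Finset.sum_congr rfl fun i _ => ?_
  simp only [fderiv_comp_add_right]
  rw [fderiv_comp_add_right (f := fun y => fderiv ℝ w y (EuclideanSpace.single i 1))]

theorem differentiable_fderiv_apply (hw : ContDiff ℝ 2 w) (e : EuclideanSpace ℝ (Fin (d + 1))) :
    Differentiable ℝ (fun y => fderiv ℝ w y e) := by
  have hd : ContDiff ℝ 1 (fderiv ℝ w) := hw.fderiv_right (by norm_num)
  exact (hd.clm_apply contDiff_const).differentiable (by norm_num)

theorem lapl_sub (hw : ContDiff ℝ 2 w) (hv : ContDiff ℝ 2 v)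
    (x : EuclideanSpace ℝ (Fin (d + 1))) :
    lapl (d + 1) (fun y => w y - v y) x = lapl (d + 1) w x - lapl (d + 1) v x := by
  unfold lapl
  rw [← Finset.sum_sub_distrib]
  refine Finset.sum_congr rfl fun i _ => ?_
  have e : ∀ y, fderiv ℝ (fun y => w y - v y) y = fderiv ℝ w y - fderiv ℝ v y := fun y =>
    fderiv_fun_sub (hw.differentiable (by norm_num) y) (hv.differentiable (by norm_num) y)
  simp only [e, _root_.sub_apply]
  rw [fderiv_fun_sub (differentiable_fderiv_apply hw _ x) (differentiable_fderiv_apply hv _ x),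
    _root_.sub_apply]

theorem lapl_const_mul (hw : ContDiff ℝ 2 w) (a : ℝ) (x : EuclideanSpace ℝ (Fin (d + 1))) :
    lapl (d + 1) (fun y => a * w y) x = a * lapl (d + 1) w x := by
  unfold lapl
  rw [Finset.mul_sum]
  refine Finset.sum_congr rfl fun i _ => ?_
  have e : ∀ y, fderiv ℝ (fun y => a * w y) y = a • fderiv ℝ w y := fun y =>
    fderiv_const_mul (hw.differentiable (by norm_num) y) a
  simp only [e, _root_.smul_apply, smul_eq_mul]
  rw [fderiv_const_mul (differentiable_fderiv_apply hw _ x) a]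
  rfl

theorem lapl_eq_zero_of_notMem_tsupport {x : EuclideanSpace ℝ (Fin (d + 1))}
    (hx : x ∉ tsupport w) : lapl (d + 1) w x = 0 := by
  have h0 : w =ᶠ[nhds x] fun _ => 0 := notMem_tsupport_iff_eventuallyEq.1 hx
  unfold lapl
  refine Finset.sum_eq_zero fun i _ => ?_
  have : (fun y => fderiv ℝ w y (EuclideanSpace.single i 1)) =ᶠ[nhds x] fun _ => 0 := by
    filter_upwards [h0.fderiv (𝕜 := ℝ)] with y hy
    simp [hy]
  rw [this.fderiv_eq]
  simp

/-- The second derivative is nonnegative at a local minimum. -/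
theorem deriv_deriv_nonneg_of_isLocalMin {φ : ℝ → ℝ} {a : ℝ} (h : IsLocalMin φ a)
    (hc : ContinuousAt φ a) : 0 ≤ deriv (deriv φ) a := by
  by_contra! hneg
  have hmax := isLocalMax_of_deriv_deriv_neg hneg h.deriv_eq_zero hc
  have hconst : φ =ᶠ[nhds a] fun _ => φ a := by
    filter_upwards [h, hmax] with y h1 h2 using le_antisymm h2 h1
  have : deriv (deriv φ) a = 0 := by
    have h1 := hconst.deriv.deriv_eq
    simpa using h1
  linarith

theorem lapl_nonneg_of_forall_le_s14 (hg : ContDiff ℝ 2 g) {x : EuclideanSpace ℝ (Fin (d + 1))}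
    (hx : ∀ y, g x ≤ g y) : 0 ≤ lapl (d + 1) g x := by
  refine Finset.sum_nonneg fun i _ => ?_
  set e : EuclideanSpace ℝ (Fin (d + 1)) := EuclideanSpace.single i 1
  have line : ∀ t : ℝ, HasDerivAt (fun t : ℝ => x + t • e) e t := fun t => by
    simpa using ((hasDerivAt_id t).smul_const e).const_add x
  have d1 : deriv (fun t : ℝ => g (x + t • e)) = fun t => fderiv ℝ g (x + t • e) e := by
    ext t
    exact ((hg.differentiable (by norm_num) _).hasFDerivAt.comp_hasDerivAt t (line t)).deriv
  have d2 : deriv (fun t : ℝ => fderiv ℝ g (x + t • e) e) 0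
      = fderiv ℝ (fun y => fderiv ℝ g y e) x e := by
    have := ((differentiable_fderiv_apply hg e (x + (0 : ℝ) • e)).hasFDerivAt.comp_hasDerivAt 0
      (line 0)).deriv
    simpa [Function.comp_def] using this
  rw [← d2, ← d1]
  refine deriv_deriv_nonneg_of_isLocalMin (.of_forall fun t => ?_) ?_
  · simpa using hx (x + t • e)
  · have := hg.continuous
    fun_prop

theorem fracLap_nonpos_of_forall_le_s14 {x : EuclideanSpace ℝ (Fin (d + 1))}
    (hx : ∀ y, g x ≤ g y) : fracLap (d + 1) s g x ≤ 0 := by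
  refine mul_nonpos_of_nonneg_of_nonpos (by norm_num) (integral_nonpos fun z => ?_)
  exact div_nonpos_of_nonpos_of_nonneg (by linarith [hx (x + z), hx (x - z)])
    (Real.rpow_nonneg (norm_nonneg z) _)

/-- At a global minimum, the fractional Laplacian sees the excess of `g` on a distant ball. -/
theorem fracLap_le_of_forall_le (hs : s ∈ Set.Ioo (0 : ℝ) 1) (hg : IsC2Bdd g)
    {x p : EuclideanSpace ℝ (Fin (d + 1))} {a r R : ℝ} (ha : 0 < a) (hR : ‖p - x‖ + r ≤ R)
    (hx : ∀ y, g x ≤ g y) (hp : ∀ y ∈ Metric.ball p r, a ≤ g y - g x) :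
    fracLap (d + 1) s g x ≤ -(1 / 2 * (a / R ^ (((d + 1 : ℕ) : ℝ) + 2 * s) *
      volume.real (Metric.ball (0 : EuclideanSpace ℝ (Fin (d + 1))) r))) := by
  set q : ℝ := ((d + 1 : ℕ) : ℝ) + 2 * s with hq
  have hq0 : 0 ≤ q := by have := hs.1; positivity
  have hind : Integrable ((Metric.ball (p - x) r).indicator fun _ => -(a / R ^ q)) := by
    rw [integrable_indicator_iff measurableSet_ball]
    exact integrableOn_const measure_ball_lt_top.ne
  have key := integral_mono (hg.integrable_fracLap hs x) hind fun z => by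
    simp only [Set.indicator]
    split_ifs with hz
    · have hz' : x + z ∈ Metric.ball p r := by
        rw [mem_ball_iff_norm] at hz ⊢
        convert hz using 2
        abel
      have h1 := hp _ hz'
      have hz0 : 0 < ‖z‖ := by
        rw [norm_pos_iff]
        rintro rfl
        simp only [add_zero, sub_self] at h1
        linarith
      have hzR : ‖z‖ ≤ R := by
        rw [mem_ball_iff_norm] at hz
        have := norm_le_norm_add_norm_sub' z (p - x)
        linarith
      rw [neg_div']
      rw [← hq]
      have hpow : ‖z‖ ^ q ≤ R ^ q := Real.rpow_le_rpow hz0.le hzR hq0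
      have hzq : 0 < ‖z‖ ^ q := Real.rpow_pos_of_pos hz0 q
      calc (2 * g x - g (x + z) - g (x - z)) / ‖z‖ ^ q ≤ -a / ‖z‖ ^ q :=
            div_le_div_of_nonneg_right (by linarith [hx (x - z)]) hzq.le
        _ ≤ -a / R ^ q := by
            rw [neg_div, neg_div, neg_le_neg_iff]
            exact div_le_div_of_nonneg_left ha.le hzq hpow
    · exact div_nonpos_of_nonpos_of_nonneg (by linarith [hx (x + z), hx (x - z)])
        (Real.rpow_nonneg (norm_nonneg z) _)
  rw [integral_indicator_const _ measurableSet_ball, smul_eq_mul,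
    Measure.addHaar_real_ball_center] at key
  unfold fracLap
  rw [← hq] at key ⊢
  linarith

/-- Localized penalization: near an almost-minimum point `x₀` of `w` there is a point where a
small perturbation `g` of `w` attains its global minimum. -/
theorem exists_penalized_min (hs : s ∈ Set.Ioo (0 : ℝ) 1) : ∃ C, 0 ≤ C ∧
    ∀ w : EuclideanSpace ℝ (Fin (d + 1)) → ℝ, IsC2Bdd w → ∀ m ε x₀, 0 < ε → (∀ y, m ≤ w y) →
      w x₀ ≤ m + ε → ∃ x g, ‖x - x₀‖ ≤ 2 ∧ w x ≤ m + ε ∧ IsC2Bdd g ∧ (∀ y, g x ≤ g y) ∧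
        (∀ y, w y - m - ε ≤ g y - g x) ∧
        -lapl (d + 1) w x + fracLap (d + 1) s w x ≤ C * ε + fracLap (d + 1) s g x := by
  let ψ : ContDiffBump (0 : EuclideanSpace ℝ (Fin (d + 1))) := ⟨1, 2, by norm_num, by norm_num⟩
  have hψ : IsC2Bdd ψ := .of_hasCompactSupport ψ.contDiff ψ.hasCompactSupport
  obtain ⟨C₁, hC₁⟩ := hψ.exists_abs_fracLap_le hs
  obtain ⟨C₂, hC₂⟩ : ∃ C, ∀ x, |lapl (d + 1) ψ x| ≤ C := by
    have hcs : HasCompactSupport (lapl (d + 1) ψ) :=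
      HasCompactSupport.intro ψ.hasCompactSupport fun x hx => lapl_eq_zero_of_notMem_tsupport hx
    refine hcs.exists_bound_of_continuous ?_
    unfold lapl
    refine continuous_finsetSum _ fun i _ => ?_
    have h1 : ContDiff ℝ 1 (fderiv ℝ ψ) := (ψ.contDiff (n := 2)).fderiv_right (by norm_num)
    have h2 : ContDiff ℝ 1 fun y => fderiv ℝ ψ y (EuclideanSpace.single i 1) :=
      h1.clm_apply contDiff_const
    exact (h2.continuous_fderiv (by norm_num)).clm_apply continuous_const
  have hC0 : 0 ≤ C₁ + C₂ := add_nonneg ((abs_nonneg _).trans (hC₁ 0)) ((abs_nonneg _).trans (hC₂ 0))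
  refine ⟨2 * (C₁ + C₂), by positivity, fun w hw m ε x₀ hε hm hx₀ => ?_⟩
  set φ : EuclideanSpace ℝ (Fin (d + 1)) → ℝ := fun y => ψ (y + -x₀) with hφ
  have hφ2 : IsC2Bdd φ := hψ.comp_add_right (-x₀)
  set g : EuclideanSpace ℝ (Fin (d + 1)) → ℝ := fun y => w y - 2 * ε * φ y with hgdef
  have hg : IsC2Bdd g := hw.sub (hφ2.const_mul (2 * ε))
  have hφ0 : φ x₀ = 1 := by
    simp only [hφ, add_neg_cancel]
    exact ψ.one_of_mem_closedBall (Metric.mem_closedBall_self zero_le_one)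
  have hφnn : ∀ y, 0 ≤ φ y := fun y => ψ.nonneg
  have hφ1 : ∀ y, φ y ≤ 1 := fun y => ψ.le_one
  have hgx₀ : g x₀ ≤ m - ε := by
    simp only [hgdef, hφ0]
    linarith
  obtain ⟨x, hxB, hxmin⟩ := (isCompact_closedBall x₀ 2).exists_isMinOn
    ⟨x₀, Metric.mem_closedBall_self (by norm_num)⟩ hg.1.continuous.continuousOn
  have hgx : g x ≤ m - ε := (hxmin (Metric.mem_closedBall_self (by norm_num))).trans hgx₀
  have hmin : ∀ y, g x ≤ g y := by
    intro y
    by_cases hy : y ∈ Metric.closedBall x₀ 2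
    · exact hxmin hy
    · have hφy : φ y = 0 := by
        refine ψ.zero_of_le_dist ?_
        rw [Metric.mem_closedBall, not_le, dist_eq_norm] at hy
        rw [dist_zero_right, ← sub_eq_add_neg]
        exact hy.le
      have : g y = w y := by simp [hgdef, hφy]
      linarith [hm y]
  have hprod : ∀ y, 0 ≤ ε * φ y ∧ ε * φ y ≤ ε := fun y =>
    ⟨mul_nonneg hε.le (hφnn y), mul_le_of_le_one_right hε.le (hφ1 y)⟩
  refine ⟨x, g, by rwa [mem_closedBall_iff_norm] at hxB, ?_, hg, hmin, fun y => ?_, ?_⟩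
  · have : g x = w x - 2 * (ε * φ x) := by simp only [hgdef]; ring
    linarith [(hprod x).2]
  · have : g y = w y - 2 * (ε * φ y) := by simp only [hgdef]; ring
    linarith [(hprod y).2]
  · have hlap : lapl (d + 1) g x = lapl (d + 1) w x - 2 * ε * lapl (d + 1) ψ (x + -x₀) := by
      rw [hgdef, lapl_sub hw.1 (hφ2.const_mul (2 * ε)).1, lapl_const_mul hφ2.1,
        lapl_comp_add_right]
    have hfrac : fracLap (d + 1) s g x
        = fracLap (d + 1) s w x - 2 * ε * fracLap (d + 1) s ψ (x + -x₀) := by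
      rw [hgdef, fracLap_sub hs hw (hφ2.const_mul (2 * ε)), fracLap_const_mul,
        fracLap_comp_add_right]
    have hl := lapl_nonneg_of_forall_le_s14 hg.1 hmin
    have b1 := (abs_le.1 (hC₁ (x + -x₀))).2
    have b2 := (abs_le.1 (hC₂ (x + -x₀))).1
    have b3 : ε * (fracLap (d + 1) s ψ (x + -x₀) - lapl (d + 1) ψ (x + -x₀)) ≤ ε * (C₁ + C₂) :=
      mul_le_mul_of_nonneg_left (by linarith) hε.le
    linarith

/-- Maximum principle for bounded functions on the whole space. -/
theorem nonneg_of_supersolution (hs : s ∈ Set.Ioo (0 : ℝ) 1) (hw : IsC2Bdd w) {c : ℝ} (hc : 0 < c)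
    (h : ∀ x, w x < 0 → -(c * w x) ≤ -lapl (d + 1) w x + fracLap (d + 1) s w x) (x) :
    0 ≤ w x := by
  by_contra! hx
  obtain ⟨C, hC0, hC⟩ := exists_penalized_min (d := d) hs
  obtain ⟨A, hA⟩ := hw.exists_abs_le
  have hbdd : BddBelow (Set.range w) :=
    ⟨-A, by rintro _ ⟨y, rfl⟩; exact (abs_le.1 (hA y)).1⟩
  set m := ⨅ y, w y
  have hm : ∀ y, m ≤ w y := fun y => ciInf_le hbdd y
  have hm0 : m < 0 := (hm x).trans_lt hx
  set ε := c * (-m) / (2 * (C + c)) with hε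
  have hε0 : 0 < ε := div_pos (mul_pos hc (by linarith)) (by positivity)
  have hεeq : ε * (2 * (C + c)) = c * (-m) := div_mul_cancel₀ _ (by positivity)
  obtain ⟨x₀, hx₀⟩ := exists_lt_of_ciInf_lt (show ⨅ y, w y < m + ε by linarith)
  obtain ⟨x, g, -, hwx, -, hmin, -, hle⟩ := hC w hw m ε x₀ hε0 hm hx₀.le
  have hcm : 0 < c * -m := mul_pos hc (by linarith)
  have hCε : 0 ≤ C * ε := by positivity
  have hneg : w x < 0 := by
    by_contra! h0
    have : 0 ≤ c * (m + ε) := mul_nonneg hc.le (by linarith)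
    nlinarith
  have h1 := h x hneg
  have h2 := fracLap_nonpos_of_forall_le_s14 (s := s) hmin
  have h3 : c * w x ≤ c * (m + ε) := mul_le_mul_of_nonneg_left hwx hc.le
  nlinarith

/-- Quantitative strong maximum principle: if a nonnegative supersolution is small at a point, it
is small at any fixed translate of that point, uniformly in the point. -/
theorem exists_pos_forall_lt_imp_translate_lt (hs : s ∈ Set.Ioo (0 : ℝ) 1) (hw : IsC2Bdd w)
    (hnn : ∀ x, 0 ≤ w x) {K : ℝ} (hK : 0 ≤ K)
    (h : ∀ x, -(K * w x) ≤ -lapl (d + 1) w x + fracLap (d + 1) s w x)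
    (b : EuclideanSpace ℝ (Fin (d + 1))) {η : ℝ} (hη : 0 < η) :
    ∃ ε > 0, ∀ x, w x < ε → w (x + b) < η := by
  obtain ⟨C, hC0, hC⟩ := exists_penalized_min (d := d) hs
  obtain ⟨L, hL0, hL⟩ := hw.exists_lipschitz
  set r := η / (2 * (L + 1)) with hr
  have hr0 : 0 < r := by positivity
  set A := 1 / 2 * (η / 4 / (‖b‖ + 2 + r) ^ (((d + 1 : ℕ) : ℝ) + 2 * s) *
      volume.real (Metric.ball (0 : EuclideanSpace ℝ (Fin (d + 1))) r)) with hAdef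
  have hA : 0 < A := by
    have h1 : 0 < volume.real (Metric.ball (0 : EuclideanSpace ℝ (Fin (d + 1))) r) :=
      ENNReal.toReal_pos (Metric.measure_ball_pos _ _ hr0).ne' measure_ball_lt_top.ne
    positivity
  refine ⟨min (η / 4) (A / (2 * (C + K + 1))), by positivity, fun x₀ hx₀ => ?_⟩
  set ε := min (η / 4) (A / (2 * (C + K + 1)))
  have hε0 : 0 < ε := by positivity
  have hε1 : ε ≤ η / 4 := min_le_left _ _
  have hε2 : ε * (2 * (C + K + 1)) ≤ A := (le_div_iff₀ (by positivity)).1 (min_le_right _ _)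
  by_contra! hbig
  obtain ⟨x, g, hxx₀, hwx, hg, hmin, hexc, hle⟩ := hC w hw 0 ε x₀ hε0 hnn (by linarith)
  have hball : ∀ y ∈ Metric.ball (x₀ + b) r, η / 4 ≤ g y - g x := by
    intro y hy
    rw [mem_ball_iff_norm] at hy
    have h1 := (abs_le.1 (hL y (x₀ + b))).1
    have h2 : L * ‖y - (x₀ + b)‖ ≤ η / 2 := by
      calc L * ‖y - (x₀ + b)‖ ≤ (L + 1) * r := by gcongr; linarith
        _ = η / 2 := by rw [hr]; field_simp
    linarith [hexc y]
  have hfr := fracLap_le_of_forall_le (s := s) (R := ‖b‖ + 2 + r) hs hg (by positivity)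
    (by
      have : x₀ + b - x = b - (x - x₀) := by abel
      rw [this]
      linarith [norm_sub_le b (x - x₀)]) hmin hball
  have h1 := h x
  have h2 : K * w x ≤ K * ε := mul_le_mul_of_nonneg_left (by linarith) hK
  rw [← hAdef] at hfr
  nlinarith

end MixedOperator

/-- If `f` is `C¹` with `f' ≤ -δ` on `|r| ≥ 1`, then `f` is strictly decreasing, with a quantitative
rate, slightly beyond this region. -/
theorem exists_strict_decrease {f : ℝ → ℝ} (hf : ContDiff ℝ 1 f)
    (hf' : ∃ δ > (0:ℝ), ∀ r : ℝ, 1 ≤ |r| → deriv f r ≤ -δ) :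
    ∃ c > 0, ∃ ε > 0, ε ≤ 1 / 2 ∧ ∀ a b, b ≤ a → (1 - ε ≤ b ∨ a ≤ -1 + ε) →
      c * (a - b) ≤ f b - f a := by
  obtain ⟨δ, hδ, hd⟩ := hf'
  have hcont : Continuous (deriv f) := hf.continuous_deriv le_rfl
  have near : ∀ p : ℝ, |p| = 1 → ∃ ε > 0, ∀ r, |r - p| < ε → deriv f r < -(δ / 2) := by
    intro p hp
    have h1 : deriv f p < -(δ / 2) := by linarith [hd p hp.ge]
    exact Metric.eventually_nhds_iff.1 (hcont.continuousAt.eventually_lt_const h1)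
  obtain ⟨ε₁, hε₁, h₁⟩ := near 1 (by simp)
  obtain ⟨ε₂, hε₂, h₂⟩ := near (-1) (by simp)
  set ε := min (1 / 2) (min (ε₁ / 2) (ε₂ / 2))
  have e0 : ε ≤ 1 / 2 := min_le_left _ _
  have e1 : ε ≤ ε₁ / 2 := (min_le_right _ _).trans (min_le_left _ _)
  have e2 : ε ≤ ε₂ / 2 := (min_le_right _ _).trans (min_le_right _ _)
  have hright : ∀ r, 1 - ε ≤ r → deriv f r ≤ -(δ / 2) := by
    intro r hr
    rcases le_total 1 r with h | h
    · linarith [hd r (h.trans (le_abs_self r))]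
    · exact (h₁ r (by rw [abs_lt]; constructor <;> linarith)).le
  have hleft : ∀ r, r ≤ -1 + ε → deriv f r ≤ -(δ / 2) := by
    intro r hr
    rcases le_total r (-1) with h | h
    · linarith [hd r ((le_neg_of_le_neg h).trans (neg_le_abs r))]
    · exact (h₂ r (by rw [abs_lt]; constructor <;> linarith)).le
  have hdf : Differentiable ℝ f := hf.differentiable (by norm_num)
  refine ⟨δ / 2, by positivity, ε, by positivity, e0, fun a b hab h => ?_⟩
  have key : f a - f b ≤ -(δ / 2) * (a - b) := by
    rcases h with h | h
    · exact (convex_Ici (1 - ε)).image_sub_le_mul_sub_of_deriv_le hf.continuous.continuousOn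
        hdf.differentiableOn (fun r hr => hright r (interior_subset hr)) b h a (h.trans hab) hab
    · exact (convex_Iic (-1 + ε)).image_sub_le_mul_sub_of_deriv_le hf.continuous.continuousOn
        hdf.differentiableOn (fun r hr => hleft r (Set.mem_Iic.1 (interior_subset hr)))
        b (hab.trans h) a h hab
  linarith

theorem exists_lipschitz_on_Icc {f : ℝ → ℝ} (hf : ContDiff ℝ 1 f) (C : ℝ) :
    ∃ K, 0 ≤ K ∧ ∀ a b, |a| ≤ C → |b| ≤ C → |f a - f b| ≤ K * |a - b| := by
  obtain ⟨K, hK⟩ := (isCompact_Icc (a := -C) (b := C)).exists_bound_of_continuousOn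
    (hf.continuous_deriv le_rfl).continuousOn
  refine ⟨max K 0, le_max_right _ _, fun a b ha hb => ?_⟩
  exact (convex_Icc (-C) C).norm_image_sub_le_of_norm_deriv_le
    (fun x _ => hf.differentiable (by norm_num) x) (fun x hx => (hK x hx).trans (le_max_left _ _))
    (abs_le.1 hb) (abs_le.1 ha)

section Sliding

variable {d : ℕ} {s : ℝ} {f : ℝ → ℝ} {u : EuclideanSpace ℝ (Fin (d + 1)) → ℝ}

theorem mixedOp_translate_sub (hs : s ∈ Set.Ioo (0 : ℝ) 1) (hu : IsC2Bdd u)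
    (heq : ∀ x, -lapl (d + 1) u x + fracLap (d + 1) s u x = f (u x))
    (h x : EuclideanSpace ℝ (Fin (d + 1))) :
    -lapl (d + 1) (fun y => u (y + h) - u y) x + fracLap (d + 1) s (fun y => u (y + h) - u y) x
      = f (u (x + h)) - f (u x) := by
  rw [lapl_sub (hu.comp_add_right h).1 hu.1, fracLap_sub hs (hu.comp_add_right h) hu,
    lapl_comp_add_right, fracLap_comp_add_right, ← heq x, ← heq (x + h)]
  ring

/-- If `u ≤ u (· + h)` and `u (x + h) - u x` is small, then `u` varies little over `m` steps of
length `h` starting from `x + b`, uniformly in `x`. -/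
theorem exists_pos_forall_lt_imp_iterate_lt (hs : s ∈ Set.Ioo (0 : ℝ) 1) (hf : ContDiff ℝ 1 f)
    (hu : IsC2Bdd u) (heq : ∀ x, -lapl (d + 1) u x + fracLap (d + 1) s u x = f (u x))
    {h : EuclideanSpace ℝ (Fin (d + 1))} (hnn : ∀ x, u x ≤ u (x + h)) (m : ℕ)
    (b : EuclideanSpace ℝ (Fin (d + 1))) {η : ℝ} (hη : 0 < η) :
    ∃ ε > 0, ∀ x, u (x + h) - u x < ε → u (x + b + (m : ℝ) • h) - u (x + b) < η := by
  obtain ⟨C, hC⟩ := hu.exists_abs_le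
  obtain ⟨K, hK, hlip⟩ := exists_lipschitz_on_Icc hf C
  induction m generalizing η with
  | zero => exact ⟨1, one_pos, fun x _ => by simpa using hη⟩
  | succ m ih =>
    obtain ⟨ε₁, hε₁, h₁⟩ := ih (half_pos hη)
    obtain ⟨ε₂, hε₂, h₂⟩ := exists_pos_forall_lt_imp_translate_lt hs ((hu.comp_add_right h).sub hu)
      (fun x => sub_nonneg.2 (hnn x)) hK (fun x => by
        rw [mixedOp_translate_sub hs hu heq]
        have h1 := (abs_le.1 (hlip (u (x + h)) (u x) (hC _) (hC _))).1
        rwa [abs_of_nonneg (sub_nonneg.2 (hnn x))] at h1) (b + (m : ℝ) • h) (half_pos hη)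
    refine ⟨min ε₁ ε₂, lt_min hε₁ hε₂, fun x hx => ?_⟩
    have a1 := h₁ x (hx.trans_le (min_le_left _ _))
    have a2 := h₂ x (hx.trans_le (min_le_right _ _))
    have e1 : x + b + ((m + 1 : ℕ) : ℝ) • h = x + (b + (m : ℝ) • h) + h := by
      push_cast
      module
    have e2 : x + b + (m : ℝ) • h = x + (b + (m : ℝ) • h) := by abel
    rw [e1]
    rw [e2] at a1
    linarith

/-- Monotonicity of `u` along every direction with positive last coordinate. -/
theorem le_translate_of_last_pos (hs : s ∈ Set.Ioo (0 : ℝ) 1) (hf : ContDiff ℝ 1 f)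
    (hf' : ∃ δ > (0:ℝ), ∀ r : ℝ, 1 ≤ |r| → deriv f r ≤ -δ) (hu : IsC2Bdd u)
    (heq : ∀ x, -lapl (d + 1) u x + fracLap (d + 1) s u x = f (u x))
    (hlim : ∀ ε > (0:ℝ), ∃ T : ℝ, ∀ x : EuclideanSpace ℝ (Fin (d + 1)),
      (T ≤ x (Fin.last d) → |u x - 1| < ε) ∧ (x (Fin.last d) ≤ -T → |u x + 1| < ε))
    {h : EuclideanSpace ℝ (Fin (d + 1))} (hh : 0 < h (Fin.last d))
    (x : EuclideanSpace ℝ (Fin (d + 1))) : u x ≤ u (x + h) := by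
  obtain ⟨c, hc, ε, hε, hε2, hdec⟩ := exists_strict_decrease hf hf'
  obtain ⟨T, hT⟩ := hlim ε hε
  have hTp : ∀ x : EuclideanSpace ℝ (Fin (d + 1)), T ≤ x (Fin.last d) → 1 - ε ≤ u x :=
    fun x hx => by linarith [(abs_lt.1 ((hT x).1 hx)).1]
  have hTm : ∀ x : EuclideanSpace ℝ (Fin (d + 1)), x (Fin.last d) ≤ -T → u x ≤ -1 + ε :=
    fun x hx => by linarith [(abs_lt.1 ((hT x).2 hx)).2]
  have comparison : ∀ k : EuclideanSpace ℝ (Fin (d + 1)),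
      (∀ x, u (x + k) < u x → 1 - ε ≤ u (x + k) ∨ u x ≤ -1 + ε) → ∀ x, u x ≤ u (x + k) := by
    intro k hk x
    refine sub_nonneg.1 (nonneg_of_supersolution hs ((hu.comp_add_right k).sub hu) hc ?_ x)
    intro x hx
    rw [mixedOp_translate_sub hs hu heq]
    have := hdec (u x) (u (x + k)) (by linarith) (hk x (by linarith))
    linarith
  obtain ⟨L, hL0, hL⟩ := hu.exists_lipschitz
  have improve : ∀ k : EuclideanSpace ℝ (Fin (d + 1)), 0 < k (Fin.last d) →
      (∀ x, u x ≤ u (x + k)) → ∃ ρ > 0, ∀ k' : EuclideanSpace ℝ (Fin (d + 1)),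
        ‖k - k'‖ ≤ ρ → 0 ≤ k' (Fin.last d) → ∀ x, u x ≤ u (x + k') := by
    intro k hk hnn
    obtain ⟨m, hm⟩ := exists_nat_ge (2 * |T| / k (Fin.last d))
    rw [div_le_iff₀ hk] at hm
    obtain ⟨μ, hμ, hμk⟩ := exists_pos_forall_lt_imp_iterate_lt hs hf hu heq hnn (2 * m)
      (-((m : ℝ) • k)) one_pos
    refine ⟨μ / (L + 1), by positivity, fun k' hk' hk'0 => comparison k' fun x hx => ?_⟩
    by_contra! hcon
    have t1 : x (Fin.last d) < T := by
      by_contra! ht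
      refine hcon.1.not_ge (hTp _ ?_)
      simp only [PiLp.add_apply]
      linarith
    have t2 : -T < x (Fin.last d) := by
      by_contra! ht
      exact hcon.2.not_ge (hTm _ ht)
    have s1 : u (x + k) - u x < μ := by
      have := (abs_le.1 (hL (x + k) (x + k'))).2
      rw [add_sub_add_left_eq_sub] at this
      have h2 : L * ‖k - k'‖ ≤ L * (μ / (L + 1)) := mul_le_mul_of_nonneg_left hk' hL0
      have h3 : L * (μ / (L + 1)) < μ := by
        rw [← mul_div_assoc, div_lt_iff₀ (by linarith)]
        nlinarith
      linarith
    have s2 := hμk x s1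
    have s3 : 1 - ε ≤ u (x + -((m : ℝ) • k) + ((2 * m : ℕ) : ℝ) • k) := by
      refine hTp _ ?_
      simp only [PiLp.add_apply, PiLp.neg_apply, PiLp.smul_apply, smul_eq_mul]
      push_cast
      linarith [le_abs_self T]
    have s4 : u (x + -((m : ℝ) • k)) ≤ -1 + ε := by
      refine hTm _ ?_
      simp only [PiLp.add_apply, PiLp.neg_apply, PiLp.smul_apply, smul_eq_mul]
      linarith [le_abs_self T]
    linarith
  set S : Set ℝ := {k | 0 ≤ k ∧ ∀ j, k ≤ j → ∀ x, u x ≤ u (x + j • h)} with hS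
  have hSne : S.Nonempty := by
    refine ⟨2 * |T| / h (Fin.last d), by positivity, fun j hj => comparison _ fun x _ => ?_⟩
    rw [div_le_iff₀ hh] at hj
    rcases le_total (x (Fin.last d)) (-T) with ht | ht
    · exact Or.inr (hTm x ht)
    · refine Or.inl (hTp _ ?_)
      simp only [PiLp.add_apply, PiLp.smul_apply, smul_eq_mul]
      linarith [le_abs_self T]
  have hSbdd : BddBelow S := ⟨0, fun k hk => hk.1⟩
  set k₀ := sInf S
  have hk₀ : 0 ≤ k₀ := le_csInf hSne fun k hk => hk.1
  have habove : ∀ j, k₀ < j → ∀ x, u x ≤ u (x + j • h) := by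
    intro j hj
    obtain ⟨k, hk, hkj⟩ := exists_lt_of_csInf_lt hSne hj
    exact hk.2 j hkj.le
  have hat : ∀ x, u x ≤ u (x + k₀ • h) := by
    intro x
    have hcont : Continuous fun j : ℝ => u (x + j • h) := by
      have := hu.1.continuous
      fun_prop
    refine ge_of_tendsto (hcont.continuousAt.continuousWithinAt (s := Set.Ioi k₀)) ?_
    filter_upwards [self_mem_nhdsWithin] with j hj using habove j hj x
  rcases hk₀.eq_or_lt with h0 | hpos
  · simpa using habove 1 (by rw [← h0]; exact one_pos) x
  exfalso
  obtain ⟨ρ, hρ, himp⟩ := improve (k₀ • h) (by simpa using mul_pos hpos hh) hat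
  set σ := min k₀ (ρ / (‖h‖ + 1))
  have hσ : 0 < σ := by positivity
  have hσ1 : σ ≤ k₀ := min_le_left _ _
  have hσ2 : σ * (‖h‖ + 1) ≤ ρ := (le_div_iff₀ (by positivity)).1 (min_le_right _ _)
  have hmem : k₀ - σ ∈ S := by
    refine ⟨by linarith, fun j hj => ?_⟩
    rcases lt_or_ge k₀ j with hj' | hj'
    · exact habove j hj'
    refine himp _ ?_ ?_
    · rw [← sub_smul, norm_smul, Real.norm_of_nonneg (by linarith)]
      have : (k₀ - j) * ‖h‖ ≤ σ * ‖h‖ :=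
        mul_le_mul_of_nonneg_right (by linarith) (norm_nonneg h)
      linarith
    · simp only [PiLp.smul_apply, smul_eq_mul]
      exact mul_nonneg (by linarith) hh.le
  linarith [csInf_le hSbdd hmem]

end Sliding

/-- Gibbons conjecture for the mixed operator: if `f ∈ C¹(ℝ)` with
`sup_{|r| ≥ 1} f'(r) < 0`, and `u ∈ C³ ∩ W^{4,∞}` solves `(-Δ + (-Δ)^s)u = f(u)` in
`ℝ^N` (`N = d + 1`, points written `x = (y,t)` with `t` the last coordinate) with
`u(y,t) → ±1` as `t → ±∞` uniformly in `y`, then `u` depends only on `t`. -/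
theorem stmt14 (d : ℕ) (s : ℝ) (hs : s ∈ Set.Ioo (0 : ℝ) 1)
    (f : ℝ → ℝ) (hf : ContDiff ℝ 1 f)
    (hf' : ∃ δ > (0:ℝ), ∀ r : ℝ, 1 ≤ |r| → deriv f r ≤ -δ)
    (u : EuclideanSpace ℝ (Fin (d + 1)) → ℝ)
    (hu : ContDiff ℝ 3 u)
    (hbdd : ∃ C, ∀ n : ℕ, n ≤ 3 → ∀ x, ‖iteratedFDeriv ℝ n u x‖ ≤ C)
    (heq : ∀ x, -lapl (d + 1) u x + fracLap (d + 1) s u x = f (u x))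
    (hlim : ∀ ε > (0:ℝ), ∃ T : ℝ, ∀ x : EuclideanSpace ℝ (Fin (d + 1)),
      (T ≤ x (Fin.last d) → |u x - 1| < ε) ∧ (x (Fin.last d) ≤ -T → |u x + 1| < ε)) :
    ∃ u₀ : ℝ → ℝ, ∀ x : EuclideanSpace ℝ (Fin (d + 1)), u x = u₀ (x (Fin.last d)) := by
  have hu2 : IsC2Bdd u := by
    obtain ⟨C, hC⟩ := hbdd
    exact ⟨hu.of_le (by norm_num), C, fun n hn => hC n (by omega)⟩
  have mono : ∀ x h : EuclideanSpace ℝ (Fin (d + 1)), h (Fin.last d) = 0 → u x ≤ u (x + h) := by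
    intro x h hh
    set e : EuclideanSpace ℝ (Fin (d + 1)) := EuclideanSpace.single (Fin.last d) 1
    have hcont : Continuous fun τ : ℝ => u (x + (h + τ • e)) := by
      have := hu.continuous
      fun_prop
    have hlim0 := hcont.continuousAt.continuousWithinAt (s := Set.Ioi (0 : ℝ)) (x := 0)
    have hle : u x ≤ u (x + (h + (0 : ℝ) • e)) := by
      refine ge_of_tendsto hlim0 ?_
      filter_upwards [self_mem_nhdsWithin] with τ hτ
      refine le_translate_of_last_pos hs hf hf' hu2 heq hlim ?_ x
      simpa [hh, e] using hτ
    simpa using hle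
  refine ⟨fun t => u (EuclideanSpace.single (Fin.last d) t), fun x => ?_⟩
  set p : EuclideanSpace ℝ (Fin (d + 1)) := EuclideanSpace.single (Fin.last d) (x (Fin.last d))
  refine le_antisymm ?_ ?_
  · simpa using mono x (p - x) (by simp [p])
  · simpa using mono p (x - p) (by simp [p])
end
end
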